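/- Let α₁,…,αₙ ∈ ℤ^d be linearly independent integer vectors and fix 1 ≤ i ≤ n. Then, in the fraction field F, σ(𝒞(α₁,…,αₙ)) + σ(𝒞(α₁,…,α_{i−1},−α_i,α_{i+1},…,αₙ)) = σ(𝒞(α₁,…,α_{i−1},α_{i+1},…,αₙ)), where the cone on the right-hand side is the (n−1)-generator simplicial cone obtained by deleting the i-th generator (and its σ is formed with the product over its n−1 generators). -/

import Mathlib

noncomputable section
open scoped BigOperators

/-- The group algebra `ℚ[ℤ^d]` (Laurent polynomials in `d` variables over `ℚ`). -/
abbrev GroupAlg (d : ℕ) : Type := AddMonoidAlgebra ℚ (Fin d → ℤ)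

instance (d : ℕ) : IsDomain (GroupAlg d) := NoZeroDivisors.to_isDomain _

/-- The fraction field `F` of `ℚ[ℤ^d]`. -/
abbrev FracF (d : ℕ) : Type := FractionRing (GroupAlg d)

/-- The monomial `x^m` for `m ∈ ℤ^d`, viewed inside the fraction field. -/
def xpow {d : ℕ} (m : Fin d → ℤ) : FracF d :=
  algebraMap (GroupAlg d) (FracF d) (AddMonoidAlgebra.single m 1)

/-- The lattice points of the half-open fundamental parallelepiped `Π^θ` of the
tuple `b = (b₁,…,bₙ)`: points `Σ tᵢ bᵢ` with `tᵢ ∈ [0,1)` for `i ∉ θ` and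
`tᵢ ∈ (0,1]` for `i ∈ θ`. -/
def parPts {d n : ℕ} (b : Fin n → Fin d → ℤ) (θ : Finset (Fin n)) : Set (Fin d → ℤ) :=
  {m | ∃ t : Fin n → ℝ,
    (∀ i ∉ θ, 0 ≤ t i ∧ t i < 1) ∧ (∀ i ∈ θ, 0 < t i ∧ t i ≤ 1) ∧
    (fun j => (m j : ℝ)) = ∑ i, t i • (fun j => (b i j : ℝ))}

/-- The rational generating function `σ(𝒞^θ(b₁,…,bₙ))
  = (Σ_{m ∈ Π^θ ∩ ℤ^d} x^m) / ∏ᵢ (1 − x^{bᵢ}) ∈ F`. -/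
def sigmaGF {d n : ℕ} (b : Fin n → Fin d → ℤ) (θ : Finset (Fin n)) : FracF d :=
  (∑ᶠ m ∈ parPts b θ, xpow m) / ∏ i, (1 - xpow (b i))

/-- Real embedding of an integer vector. -/
def rv {d : ℕ} (m : Fin d → ℤ) : Fin d → ℝ := fun j => (m j : ℝ)

lemma rv_add {d : ℕ} (m k : Fin d → ℤ) : rv (m + k) = rv m + rv k := by
  funext j; simp [rv]

lemma rv_neg {d : ℕ} (m : Fin d → ℤ) : rv (-m) = - rv m := by
  funext j; simp [rv]

lemma xpow_add {d : ℕ} (m k : Fin d → ℤ) : xpow (m + k) = xpow m * xpow k := by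
  simp only [xpow, ← map_mul, AddMonoidAlgebra.single_mul_single, mul_one]

lemma xpow_zero {d : ℕ} : xpow (0 : Fin d → ℤ) = 1 := by
  have : (AddMonoidAlgebra.single (0 : Fin d → ℤ) (1 : ℚ)) = 1 := rfl
  simp [xpow, this]

lemma xpow_ne_one {d : ℕ} (m : Fin d → ℤ) (hm : m ≠ 0) : xpow m ≠ 1 := by
  rw [← xpow_zero]
  intro h
  have h1 := IsFractionRing.injective (GroupAlg d) (FracF d) h
  exact hm ((AddMonoidAlgebra.single_left_inj (one_ne_zero (α := ℚ))).1 h1)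

/-- Lattice points with the distinguished coordinate in `S`. -/
def slabPts {d n : ℕ} (a : Fin d → ℤ) (b : Fin n → Fin d → ℤ) (S : Set ℝ) :
    Set (Fin d → ℤ) :=
  {m | ∃ s ∈ S, ∃ u : Fin n → ℝ, (∀ k, 0 ≤ u k ∧ u k < 1) ∧
    rv m = s • rv a + ∑ k, u k • rv (b k)}

lemma slab_union {d n : ℕ} (a : Fin d → ℤ) (b : Fin n → Fin d → ℤ) (S T : Set ℝ) :
    slabPts a b (S ∪ T) = slabPts a b S ∪ slabPts a b T := by
  ext m
  constructor
  · rintro ⟨s, hs | hs, h⟩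
    · exact Or.inl ⟨s, hs, h⟩
    · exact Or.inr ⟨s, hs, h⟩
  · rintro (⟨s, hs, h⟩ | ⟨s, hs, h⟩)
    · exact ⟨s, Or.inl hs, h⟩
    · exact ⟨s, Or.inr hs, h⟩

lemma slab_shift {d n : ℕ} (a : Fin d → ℤ) (b : Fin n → Fin d → ℤ) (S : Set ℝ) :
    slabPts a b ((fun s => 1 + s) '' S) = (fun m => a + m) '' slabPts a b S := by
  ext m
  constructor
  · rintro ⟨_, ⟨s, hs, rfl⟩, u, hu, h⟩
    refine ⟨m - a, ⟨s, hs, u, hu, ?_⟩, by simp⟩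
    rw [sub_eq_add_neg, rv_add, rv_neg, h]
    module
  · rintro ⟨m, ⟨s, hs, u, hu, h⟩, rfl⟩
    refine ⟨1 + s, ⟨s, hs, rfl⟩, u, hu, ?_⟩
    simp only [rv_add, h]
    module

lemma slab_finite {d n : ℕ} (a : Fin d → ℤ) (b : Fin n → Fin d → ℤ) (S : Set ℝ)
    (hS : S ⊆ Set.Icc (-1) 1) : (slabPts a b S).Finite := by
  refine (Set.finite_Icc (fun j => - (|a j| + ∑ k, |b k j|))
    (fun j => |a j| + ∑ k, |b k j|)).subset ?_
  rintro m ⟨s, hs, u, hu, h⟩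
  have key : ∀ j, |m j| ≤ |a j| + ∑ k, |b k j| := by
    intro j
    have hj := congrFun h j
    simp only [rv, Pi.add_apply, Pi.smul_apply, Finset.sum_apply, smul_eq_mul] at hj
    have : |(m j : ℝ)| ≤ |(a j : ℝ)| + ∑ k, |(b k j : ℝ)| := by
      rw [hj]
      refine (abs_add_le _ _).trans (add_le_add ?_ ((Finset.abs_sum_le_sum_abs _ _).trans
        (Finset.sum_le_sum fun k _ => ?_)))
      · rw [abs_mul]
        exact mul_le_of_le_one_left (abs_nonneg _) (abs_le.2 (hS hs))
      · rw [abs_mul, abs_of_nonneg (hu k).1]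
        exact mul_le_of_le_one_left (abs_nonneg _) (hu k).2.le
    exact_mod_cast this
  exact ⟨fun j => (abs_le.1 (key j)).1, fun j => (abs_le.1 (key j)).2⟩

lemma slab_disjoint {d n : ℕ} (α : Fin (n + 1) → Fin d → ℤ)
    (hα : LinearIndependent ℤ α) (i : Fin (n + 1)) (S T : Set ℝ) (hST : Disjoint S T) :
    Disjoint (slabPts (α i) (fun k => α (i.succAbove k)) S)
      (slabPts (α i) (fun k => α (i.succAbove k)) T) := by
  rw [Set.disjoint_left]
  rintro m ⟨s, hs, u, -, h⟩ ⟨t, ht, v, -, h'⟩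
  have hR : LinearIndependent ℝ (fun k => rv (α k)) :=
    (linearIndependent_algebraMap_comp_iff (R := ℤ) (S := ℝ)).2 hα
  rw [Fintype.linearIndependent_iff] at hR
  have := hR (i.insertNth (s - t) (u - v)) (by
    rw [Fin.sum_univ_succAbove _ i]
    simp only [Fin.insertNth_apply_same, Fin.insertNth_apply_succAbove, Pi.sub_apply, sub_smul,
      Finset.sum_sub_distrib]
    rw [h] at h'
    rw [sub_add_sub_comm, h', sub_self]) i
  simp only [Fin.insertNth_apply_same, sub_eq_zero] at this
  exact Set.disjoint_left.1 hST hs (this ▸ ht)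

lemma par_eq_slab {d n : ℕ} (α : Fin (n + 1) → Fin d → ℤ) (i : Fin (n + 1)) :
    parPts α ∅ = slabPts (α i) (fun k => α (i.succAbove k)) (Set.Ico 0 1) := by
  ext m
  constructor
  · rintro ⟨t, ht, -, h⟩
    refine ⟨t i, ht i (by simp), fun k => t (i.succAbove k), fun k => ht _ (by simp), ?_⟩
    rw [Fin.sum_univ_succAbove _ i] at h
    exact h
  · rintro ⟨s, hs, u, hu, h⟩
    refine ⟨i.insertNth s u, ?_, by simp, ?_⟩
    · intro k _
      refine Fin.succAboveCases i ?_ (fun k => ?_) k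
      · simpa using hs
      · simpa using hu k
    · rw [Fin.sum_univ_succAbove _ i]
      simp only [Fin.insertNth_apply_same, Fin.insertNth_apply_succAbove]
      exact h

lemma slab_neg {d n : ℕ} (a : Fin d → ℤ) (b : Fin n → Fin d → ℤ) :
    slabPts (-a) b (Set.Ico 0 1) = slabPts a b (Set.Ioc (-1) 0) := by
  ext m
  constructor
  · rintro ⟨s, hs, u, hu, h⟩
    refine ⟨-s, ⟨by linarith [hs.2], by linarith [hs.1]⟩, u, hu, ?_⟩
    rw [h, rv_neg, smul_neg, neg_smul]
  · rintro ⟨s, hs, u, hu, h⟩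
    refine ⟨-s, ⟨by linarith [hs.2], by linarith [hs.1]⟩, u, hu, ?_⟩
    rw [h, rv_neg, smul_neg, neg_smul, neg_neg]

lemma par_eq_slab_zero {d n : ℕ} (a : Fin d → ℤ) (b : Fin n → Fin d → ℤ) :
    parPts b ∅ = slabPts a b {0} := by
  ext m
  constructor
  · rintro ⟨t, ht, -, h⟩
    refine ⟨0, rfl, t, fun k => ht _ (by simp), ?_⟩
    rw [zero_smul, zero_add]
    exact h
  · rintro ⟨s, rfl, u, hu, h⟩
    refine ⟨u, fun k _ => hu k, by simp, ?_⟩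
    rw [zero_smul, zero_add] at h
    exact h

lemma sum_shift {d n : ℕ} (a : Fin d → ℤ) (b : Fin n → Fin d → ℤ) (S : Set ℝ)
    (hS : S ⊆ Set.Icc (-1) 1) :
    ∑ᶠ m ∈ slabPts a b ((fun s => 1 + s) '' S), xpow m
      = xpow a * ∑ᶠ m ∈ slabPts a b S, xpow m := by
  rw [slab_shift, finsum_mem_image (add_right_injective a).injOn]
  simp only [xpow_add]
  exact ((AddMonoidHom.mulLeft (xpow a)).map_finsum_mem _ (slab_finite a b S hS)).symm

/-- Lemma 3.4(iii): `σ(𝒞(A)) + σ(𝒞(A[(i→−1)])) = σ(𝒞(A[(i→𝟎)]))`,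
where the right-hand cone has the `i`-th generator deleted. -/
theorem sigma_add_sigma_neg_eq_deleted {d n : ℕ} (α : Fin (n + 1) → Fin d → ℤ)
    (hα : LinearIndependent ℤ α) (i : Fin (n + 1)) :
    sigmaGF α ∅ + sigmaGF (Function.update α i (-α i)) ∅ =
      sigmaGF (fun m : Fin n => α (i.succAbove m)) ∅ := by
  classical
  have hne : α i ≠ 0 := hα.ne_zero i
  set b : Fin n → Fin d → ℤ := fun k => α (i.succAbove k) with hb
  set a := α i with ha
  have hx : (1 - xpow a : FracF d) ≠ 0 := sub_ne_zero.2 (xpow_ne_one a hne).symm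
  have hx' : (1 - xpow (-a) : FracF d) ≠ 0 :=
    sub_ne_zero.2 (xpow_ne_one (-a) (neg_ne_zero.2 hne)).symm
  have hinv : xpow a * xpow (-a) = 1 := by rw [← xpow_add, add_neg_cancel, xpow_zero]
  have e1 : parPts α ∅ = slabPts a b ({0} ∪ Set.Ioo 0 1) := by
    rw [par_eq_slab α i, Set.union_comm, Set.Ioo_union_left zero_lt_one]
  have e2 : parPts (Function.update α i (-a)) ∅ = slabPts a b (Set.Ioc (-1) 0) := by
    rw [par_eq_slab _ i, ← slab_neg]
    simp [hb]
  have e3 : parPts b ∅ = slabPts a b {0} := par_eq_slab_zero a b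
  have s1 := sum_shift a b (Set.Ioc (-1) 0) (fun x hx => ⟨hx.1.le, hx.2.trans zero_le_one⟩)
  have s2 := sum_shift a b {0} (by rintro x rfl; simp)
  have i1 : (fun s : ℝ => 1 + s) '' Set.Ioc (-1) 0 = Set.Ioo 0 1 ∪ {1} := by
    rw [Set.Ioo_union_right zero_lt_one, Set.image_const_add_Ioc]
    norm_num
  have i2 : (fun s : ℝ => 1 + s) '' {0} = {1} := by simp
  have fin0 : (slabPts a b {0}).Finite := slab_finite a b _ (by rintro x rfl; simp)
  have fin1 : (slabPts a b {1}).Finite := slab_finite a b _ (by rintro x rfl; simp)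
  have finI : (slabPts a b (Set.Ioo 0 1)).Finite :=
    slab_finite a b _ (fun x hx => ⟨by linarith [hx.1], hx.2.le⟩)
  rw [i1, slab_union, finsum_mem_union
    (slab_disjoint α hα i _ _ (by simp)) finI fin1] at s1
  rw [i2] at s2
  have hprod1 : ∏ k, (1 - xpow (α k)) = (1 - xpow a) * ∏ k, (1 - xpow (b k)) :=
    Fin.prod_univ_succAbove _ i
  have hprod2 : ∏ k, (1 - xpow (Function.update α i (-a) k))
      = (1 - xpow (-a)) * ∏ k, (1 - xpow (b k)) := by
    rw [Fin.prod_univ_succAbove _ i]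
    simp [hb]
  unfold sigmaGF
  rw [hprod1, hprod2, e1, e2, e3, slab_union, finsum_mem_union
    (slab_disjoint α hα i _ _ (by simp)) fin0 finI]
  generalize (∑ᶠ m ∈ slabPts a b {0}, xpow m) = N0 at *
  generalize (∑ᶠ m ∈ slabPts a b {1}, xpow m) = N1 at *
  generalize (∑ᶠ m ∈ slabPts a b (Set.Ioo 0 1), xpow m) = NI at *
  generalize (∑ᶠ m ∈ slabPts a b (Set.Ioc (-1) 0), xpow m) = NM at *
  rw [← div_div, ← div_div, ← add_div]
  congr 1
  rw [div_add_div _ _ hx hx', div_eq_iff (mul_ne_zero hx hx')]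
  linear_combination (-(1 - xpow (-a))) * s2 + (1 - xpow (-a)) * s1 - NM * hinv
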